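/- If G is a finite simple connected graph on a vertex set V with n = |V| ≥ 3 vertices, then there exist a vertex j ∈ V, a function f : V → ℝ with f ≥ 0, and another finite simple connected graph G' on the same vertex set V, such that M_G f(j) < M_{G'} f(j). In particular, there is no graph on V whose maximal operator dominates pointwise the maximal operators of all graphs on V. -/

import Mathlib

open scoped Classical
open Finset

noncomputable section

variable {V : Type*} [Fintype V]

/-- metric ball of radius `r` centered at `v` in the graph `G` -/
def gBall (G : SimpleGraph V) (v : V) (r : ℕ) : Finset V :=
  Finset.univ.filter fun w => G.dist v w ≤ r

/-- Hardy–Littlewood maximal operator on the graph `G` -/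
def maxOp (G : SimpleGraph V) (f : V → ℝ) (v : V) : ℝ :=
  ⨆ k : Fin (Fintype.card V), (∑ w ∈ gBall G v k.1, |f w|) / ((gBall G v k.1).card : ℝ)

/-- ℓ^p (quasi)norm of a function on the vertices -/
def pNorm (p : ℝ) (f : V → ℝ) : ℝ := (∑ v, |f v| ^ p) ^ (1 / p)

/-- operator (quasi)norm of the maximal operator of `G` on ℓ^p -/
def opNorm (G : SimpleGraph V) (p : ℝ) : ℝ :=
  ⨆ f : {f : V → ℝ // f ≠ 0}, pNorm p (maxOp G f.1) / pNorm p f.1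

/-- weak ℓ^p norm -/
def wNorm (p : ℝ) (f : V → ℝ) : ℝ :=
  ⨆ t : {t : ℝ // 0 < t},
    t.1 * ((Finset.univ.filter fun v => t.1 < |f v|).card : ℝ) ^ (1 / p)

/-- weak-type operator norm of the maximal operator of `G` -/
def wOpNorm (G : SimpleGraph V) (p : ℝ) : ℝ :=
  ⨆ f : {f : V → ℝ // f ≠ 0}, wNorm p (maxOp G f.1) / pNorm p f.1

/-- maximal operator over all graphs on `V` isomorphic to `G` -/
def maxOpIso (G : SimpleGraph V) (f : V → ℝ) (j : V) : ℝ :=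
  ⨆ H : {H : SimpleGraph V // Nonempty (H ≃g G)}, maxOp H.1 f j

/-- operator norm of `maxOpIso` on ℓ^p -/
def opNormIso (G : SimpleGraph V) (p : ℝ) : ℝ :=
  ⨆ f : {f : V → ℝ // f ≠ 0}, pNorm p (maxOpIso G f.1) / pNorm p f.1

/-- Kronecker delta at `k` -/
def kdelta (k : V) : V → ℝ := fun j => if j = k then 1 else 0

/-- star graph on `Fin n` with center `0` -/
def starGraph (n : ℕ) : SimpleGraph (Fin n) :=
  SimpleGraph.fromRel fun i _ => i.1 = 0

/-- diameter of a graph -/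
def gDiam (G : SimpleGraph V) : ℕ :=
  Finset.univ.sup fun p : V × V => G.dist p.1 p.2

/-- dilation index of a graph -/
def dilIndex (G : SimpleGraph V) : ℝ :=
  ⨆ x : V, ⨆ r : {r : ℕ // r ≤ gDiam G},
    ((gBall G x (3 * r.1)).card : ℝ) / ((gBall G x r.1).card : ℝ)

/-- overlapping index of a graph -/
def overlapIndex (G : SimpleGraph V) : ℕ :=
  sInf { r : ℕ | ∀ J : Finset (V × ℕ), ∃ I ⊆ J,
    J.biUnion (fun j => gBall G j.1 j.2) = I.biUnion (fun i => gBall G i.1 i.2) ∧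
    ∀ v : V, (I.filter fun i => v ∈ gBall G i.1 i.2).card ≤ r }

theorem sum_abs_kdelta {U : Type*} (s : Finset U) (k : U) :
    ∑ w ∈ s, |kdelta k w| = if k ∈ s then 1 else 0 := by
  simp [kdelta, apply_ite abs]

theorem maxOp_kdelta_le {G : SimpleGraph V} (hG : G.Connected) {j k : V} (hjk : j ≠ k)
    (hj : 2 ≤ G.degree j) : maxOp G (kdelta k) j ≤ 1 / 3 := by
  have : Nonempty (Fin (Fintype.card V)) := ⟨⟨0, Fintype.card_pos_iff.mpr ⟨j⟩⟩⟩
  refine ciSup_le fun r => ?_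
  rw [sum_abs_kdelta]
  split_ifs with hk
  · have hr : 1 ≤ (r : ℕ) :=
      (Nat.succ_le_of_lt (hG.pos_dist_of_ne hjk)).trans (by simpa [gBall] using hk)
    have hsub : insert j (G.neighborFinset j) ⊆ gBall G j r := by
      intro w hw
      rcases Finset.mem_insert.mp hw with rfl | hw
      · simp [gBall]
      · have hadj : G.Adj j w := by simpa using hw
        simpa [gBall, SimpleGraph.dist_eq_one_iff_adj.mpr hadj] using hr
    have hcard := Finset.card_le_card hsub
    rw [Finset.card_insert_of_notMem (by simp), G.card_neighborFinset_eq_degree] at hcard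
    exact one_div_le_one_div_of_le (by norm_num)
      (by exact_mod_cast (by omega : 3 ≤ (gBall G j r).card))
  · norm_num

theorem gBall_starGraph_one {j k : V} (hjk : j ≠ k) :
    gBall (SimpleGraph.starGraph k) j 1 = {j, k} := by
  ext w
  simp only [gBall, Finset.mem_filter, Finset.mem_univ, true_and, Finset.mem_insert,
    Finset.mem_singleton, Nat.le_one_iff_eq_zero_or_eq_one,
    (SimpleGraph.connected_starGraph k).dist_eq_zero_iff, SimpleGraph.dist_eq_one_iff_adj,
    SimpleGraph.starGraph_adj]
  grind

theorem one_half_le_maxOp_starGraph_kdelta {j k : V} (hjk : j ≠ k) :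
    1 / 2 ≤ maxOp (SimpleGraph.starGraph k) (kdelta k) j := by
  have hcard : 1 < Fintype.card V := Fintype.one_lt_card_iff.mpr ⟨j, k, hjk⟩
  refine le_trans (le_of_eq ?_) (le_ciSup (Set.finite_range _).bddAbove ⟨1, hcard⟩)
  rw [sum_abs_kdelta, gBall_starGraph_one hjk, Finset.card_pair hjk]
  simp

theorem exists_two_le_degree {G : SimpleGraph V} (hG : G.Connected)
    (hV : 3 ≤ Fintype.card V) : ∃ j, 2 ≤ G.degree j := by
  by_contra! h
  have hsum : ∑ v, G.degree v ≤ Fintype.card V := by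
    simpa using Finset.sum_le_sum fun v (_ : v ∈ Finset.univ) => Nat.le_of_lt_succ (h v)
  have hE := hG.card_vert_le_card_edgeSet_add_one
  rw [Nat.card_eq_fintype_card, Nat.card_eq_fintype_card, ← SimpleGraph.edgeFinset_card] at hE
  rw [G.sum_degrees_eq_twice_card_edges] at hsum
  omega

/-- no graph has the pointwise largest maximal operator. -/
theorem stmt1 (n : ℕ) (hn : 3 ≤ n) (G : SimpleGraph (Fin n)) (hG : G.Connected) :
    ∃ (j : Fin n) (f : Fin n → ℝ) (G' : SimpleGraph (Fin n)),
      G'.Connected ∧ (∀ v, 0 ≤ f v) ∧ maxOp G f j < maxOp G' f j := by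
  obtain ⟨j, hj⟩ := exists_two_le_degree hG (by simpa using hn)
  have : Nontrivial (Fin n) := Fin.nontrivial_iff_two_le.mpr (by omega)
  obtain ⟨k, hkj⟩ := exists_ne j
  refine ⟨j, kdelta k, SimpleGraph.starGraph k, SimpleGraph.connected_starGraph k,
    fun v => by unfold kdelta; split_ifs <;> norm_num, ?_⟩
  exact (maxOp_kdelta_le hG hkj.symm hj).trans_lt
    (lt_of_lt_of_le (by norm_num) (one_half_le_maxOp_starGraph_kdelta hkj.symm))
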